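/- arXiv:1910.11055 — 2 statements merged into one kernel-verified Lean document; each statement's English description precedes it below -/
import Mathlib

section
/- Let E be a vector lattice with the principal projection property, F a vector lattice, Φ : 𝔅(E) → 𝔅(F) a Boolean homomorphism, and T : E → F atomic subordinate to Φ. Then T is orthogonally additive: T(x + y) = T x + T y for all x, y ∈ E with x ⊥ y. -/
namespace VL

/-- Two elements of a vector lattice are disjoint if `|x| ⊓ |y| = 0`. -/
def VDisjoint {G : Type*} [Lattice G] [AddCommGroup G] (x y : G) : Prop :=
  |x| ⊓ |y| = 0

/-- `y` is a fragment of `x` if `y ⊥ (x - y)`. -/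
def Fragment {G : Type*} [Lattice G] [AddCommGroup G] (y x : G) : Prop :=
  VDisjoint y (x - y)

/-- An order projection: a linear idempotent `π` with `0 ≤ π x ≤ x` for all `x ≥ 0`. -/
def IsOrderProjection {G : Type*} [Lattice G] [AddCommGroup G] [Module ℝ G]
    (π : G →ₗ[ℝ] G) : Prop :=
  (∀ x, π (π x) = π x) ∧ ∀ x : G, 0 ≤ x → 0 ≤ π x ∧ π x ≤ x

/-- A map between the order projections of `E` and of `F` is a Boolean homomorphism if it
maps order projections to order projections and preserves the Boolean operations
`π ∧ ρ = π ∘ ρ`, `π ∨ ρ = π + ρ - π ∘ ρ` and `compl π = Id - π`. -/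
def IsBooleanHom {E F : Type*} [Lattice E] [AddCommGroup E] [Module ℝ E]
    [Lattice F] [AddCommGroup F] [Module ℝ F]
    (Φ : (E →ₗ[ℝ] E) → (F →ₗ[ℝ] F)) : Prop :=
  (∀ π, IsOrderProjection π → IsOrderProjection (Φ π)) ∧
  (∀ π ρ, IsOrderProjection π → IsOrderProjection ρ →
    Φ (π ∘ₗ ρ) = Φ π ∘ₗ Φ ρ) ∧
  (∀ π ρ, IsOrderProjection π → IsOrderProjection ρ →
    Φ (π + ρ - π ∘ₗ ρ) = Φ π + Φ ρ - Φ π ∘ₗ Φ ρ) ∧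
  (∀ π, IsOrderProjection π → Φ (LinearMap.id - π) = LinearMap.id - Φ π)

/-- `T` is atomic subordinate to `Φ` if `T (π x) = Φ(π) (T x)` for every order projection. -/
def IsAtomic {E F : Type*} [Lattice E] [AddCommGroup E] [Module ℝ E]
    [Lattice F] [AddCommGroup F] [Module ℝ F]
    (Φ : (E →ₗ[ℝ] E) → (F →ₗ[ℝ] F)) (T : E → F) : Prop :=
  ∀ π : E →ₗ[ℝ] E, IsOrderProjection π → ∀ x : E, T (π x) = Φ π (T x)

/-- The principal projection property: for every `x` there is an order projection `π_x`
(the projection onto the band generated by `x`) such that `z - π_x z ⊥ x` for all `z`,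
and `π_x z ⊥ w` whenever `w ⊥ x`. -/
def HasPPP (E : Type*) [Lattice E] [AddCommGroup E] [Module ℝ E] : Prop :=
  ∀ x : E, ∃ π : E →ₗ[ℝ] E, IsOrderProjection π ∧
    (∀ z : E, VDisjoint (z - π z) x) ∧
    (∀ z w : E, VDisjoint w x → VDisjoint (π z) w)

/-- Dedekind completeness: every nonempty set bounded above has a supremum. -/
def DedekindComplete (F : Type*) [Lattice F] : Prop :=
  ∀ S : Set F, S.Nonempty → BddAbove S → ∃ b, IsLUB S b


/-- An element disjoint from both `b` and `c` and equal to `b - c` is zero. -/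
theorem eq_zero_of_vdisjoint {G : Type*} [Lattice G] [AddCommGroup G]
    [CovariantClass G G (· + ·) (· ≤ ·)] {a b c : G}
    (hb : VDisjoint a b) (hc : VDisjoint a c) (h : a = b - c) : a = 0 := by
  unfold VDisjoint at hb hc
  have h0 : ∀ z : G, 0 ≤ |z| := fun z => abs_nonneg z
  have h1 : |a| ≤ |b| + |c| := by
    rw [h]
    refine sup_le ?_ ?_
    · rw [sub_eq_add_neg]
      exact add_le_add (le_abs_self b) (neg_le_abs c)
    · rw [neg_sub, sub_eq_add_neg, add_comm]
      exact add_le_add (neg_le_abs b) (le_abs_self c)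
  have h2 : |a| - |c| ≤ |a| ⊓ |b| :=
    le_inf (sub_le_self _ (h0 c)) (sub_le_iff_le_add.2 h1)
  rw [hb] at h2
  have h3 : |a| ≤ |c| := sub_nonpos.1 h2
  rw [inf_eq_left.2 h3] at hc
  have h4 : a ≤ 0 := hc ▸ le_abs_self a
  have h5 : -a ≤ 0 := hc ▸ neg_le_abs a
  exact le_antisymm h4 (neg_nonpos.1 h5)

theorem vdisjoint_symm {G : Type*} [Lattice G] [AddCommGroup G] {a b : G}
    (h : VDisjoint a b) : VDisjoint b a := by
  unfold VDisjoint at *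
  rw [inf_comm]; exact h

variable {E F : Type*}
  [Lattice E] [AddCommGroup E] [Module ℝ E]
  [CovariantClass E E (· + ·) (· ≤ ·)] [PosSMulMono ℝ E]
  [Lattice F] [AddCommGroup F] [Module ℝ F]
  [CovariantClass F F (· + ·) (· ≤ ·)] [PosSMulMono ℝ F]

/-- an atomic operator on a vector lattice with the principal projection
property is orthogonally additive. -/
theorem atomic_orthogonally_additive
    (hE : HasPPP E) (Φ : (E →ₗ[ℝ] E) → (F →ₗ[ℝ] F)) (hΦ : IsBooleanHom Φ)
    (T : E → F) (hT : IsAtomic Φ T) :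
    ∀ x y : E, VDisjoint x y → T (x + y) = T x + T y := by
  intro x y hxy
  obtain ⟨π, hπ, h1, h2⟩ := hE x
  have hx : x - π x = 0 :=
    eq_zero_of_vdisjoint (h1 x) (vdisjoint_symm (h2 x _ (h1 x))) rfl
  have hy : π y = 0 :=
    eq_zero_of_vdisjoint (h2 y y (vdisjoint_symm hxy)) (h2 y _ (h1 y))
      (sub_sub_cancel y (π y)).symm
  have hx' : π x = x := (sub_eq_zero.1 hx).symm
  have hc : IsOrderProjection (LinearMap.id - π) := by
    refine ⟨fun z => ?_, fun z hz => ⟨?_, ?_⟩⟩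
    · simp [hπ.1]
    · simpa using (hπ.2 z hz).2
    · simpa using (hπ.2 z hz).1
  have e1 := hT π hπ (x + y)
  have e2 := hT _ hc (x + y)
  rw [hΦ.2.2.2 π hπ] at e2
  simp only [map_add, LinearMap.sub_apply, LinearMap.id_apply, hx', hy, add_zero, sub_zero,
    sub_self, zero_add] at e1 e2
  rw [e1, e2]
  abel

end VL
end

section
/- Let (A, Σ, μ) and (B, Ξ, ν) be σ-finite measure spaces, and let λ_A and λ_B be finite measures equivalent to μ and ν respectively, defining the metrics ρ(f, g) = ∫ |f − g|/(1 + |f − g|) dλ on L⁰(μ) and L⁰(ν) (convergence in these metrics is convergence in measure). Let Φ : Σ → Ξ be a Boolean isomorphism of the measure algebras: up to null sets Φ preserves intersections, unions and complements, μ(A') = 0 iff ν(Φ(A')) = 0, and every set in Ξ coincides up to a ν-null set with Φ(A') for some A' ∈ Σ. Let S : L⁰(μ) → L⁰(ν) be the associated shift operator: a positive linear bijection with positive inverse satisfying S(1_{A'}) = 1_{Φ(A')} for all A' ∈ Σ and S(sup_n f_n) = sup_n S(f_n) for every increasing, order bounded sequence of positive functions. Let T : L⁰(μ) → L⁰(ν)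 be a regular orthogonally additive operator. Then the following are equivalent: (1) T is continuous with respect to the metrics ρ and satisfies T(f·1_{A'}) = (T f)·1_{Φ(A')} ν-a.e. for every f ∈ L⁰(μ) and A' ∈ Σ (i.e. T is atomic subordinate to Φ); (2) there exists a 𝔎-function N : B × ℝ → ℝ such that T f = N(·, (S f)(·)) ν-a.e. for every f ∈ L⁰(μ). -/
open MeasureTheory

/-- The metric `ρ(f, g) = ∫ |f - g| / (1 + |f - g|) dλ` on `L⁰`, computed with respect to
a finite measure `λ` equivalent to the given measure. -/
noncomputable def rhoL0 {X : Type*} [MeasurableSpace X] (lam : Measure X)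
    (f g : X → ℝ) : ℝ :=
  ∫ x, |f x - g x| / (1 + |f x - g x|) ∂lam

structure ShiftData {A B : Type*} [MeasurableSpace A] [MeasurableSpace B]
    (μ : Measure A) (ν : Measure B) (Φ : Set A → Set B) (S : (A → ℝ) → B → ℝ) : Prop where
  null : ∀ s : Set A, MeasurableSet s → (μ s = 0 ↔ ν (Φ s) = 0)
  compl : ∀ s : Set A, MeasurableSet s → (Φ sᶜ : Set B) =ᵐ[ν] ((Φ s)ᶜ : Set B)
  surjΦ : ∀ D : Set B, MeasurableSet D →
      ∃ s : Set A, MeasurableSet s ∧ (Φ s : Set B) =ᵐ[ν] D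
  meas : ∀ f : A → ℝ, Measurable f → Measurable (S f)
  ae : ∀ f g : A → ℝ, Measurable f → Measurable g → f =ᵐ[μ] g → S f =ᵐ[ν] S g
  add : ∀ f g : A → ℝ, Measurable f → Measurable g →
      (S fun a => f a + g a) =ᵐ[ν] fun b => S f b + S g b
  smul : ∀ (c : ℝ) (f : A → ℝ), Measurable f →
      (S fun a => c * f a) =ᵐ[ν] fun b => c * S f b
  pos : ∀ f : A → ℝ, Measurable f → (∀ᵐ a ∂μ, 0 ≤ f a) → ∀ᵐ b ∂ν, 0 ≤ S f b
  invpos : ∀ f : A → ℝ, Measurable f → (∀ᵐ b ∂ν, 0 ≤ S f b) → ∀ᵐ a ∂μ, 0 ≤ f a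
  inj : ∀ f g : A → ℝ, Measurable f → Measurable g → S f =ᵐ[ν] S g → f =ᵐ[μ] g
  surj : ∀ g : B → ℝ, Measurable g → ∃ f : A → ℝ, Measurable f ∧ S f =ᵐ[ν] g
  ind : ∀ s : Set A, MeasurableSet s →
      (S (s.indicator fun _ => (1 : ℝ))) =ᵐ[ν] (Φ s).indicator fun _ => (1 : ℝ)

namespace ShiftData

variable {A B : Type*} [MeasurableSpace A] [MeasurableSpace B]
    {μ : Measure A} {ν : Measure B} {Φ : Set A → Set B} {S : (A → ℝ) → B → ℝ}

theorem sub (h : ShiftData μ ν Φ S) {f g : A → ℝ} (hf : Measurable f) (hg : Measurable g) :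
    (S fun a => f a - g a) =ᵐ[ν] fun b => S f b - S g b := by
  have h1 := h.add f (fun a => (-1) * g a) hf (hg.const_mul _)
  have h2 := h.smul (-1) g hg
  have e : (fun a => f a + (-1) * g a) = fun a => f a - g a := by ext a; ring
  rw [e] at h1
  filter_upwards [h1, h2] with b h1 h2
  rw [h1, h2]; ring

theorem mono (h : ShiftData μ ν Φ S) {f g : A → ℝ} (hf : Measurable f) (hg : Measurable g)
    (hfg : ∀ᵐ a ∂μ, f a ≤ g a) : ∀ᵐ b ∂ν, S f b ≤ S g b := by
  have h1 := h.pos (fun a => g a - f a) (hg.sub hf) (by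
    filter_upwards [hfg] with a ha; linarith)
  filter_upwards [h1, h.sub hg hf] with b h1 h2
  rw [h2] at h1; linarith

theorem le_of (h : ShiftData μ ν Φ S) {f g : A → ℝ} (hf : Measurable f) (hg : Measurable g)
    (hfg : ∀ᵐ b ∂ν, S f b ≤ S g b) : ∀ᵐ a ∂μ, f a ≤ g a := by
  have h1 := h.invpos (fun a => g a - f a) (hg.sub hf) (by
    filter_upwards [hfg, h.sub hg hf] with a ha h2; rw [h2]; linarith)
  filter_upwards [h1] with b h1
  linarith

theorem const (h : ShiftData μ ν Φ S) (c : ℝ) : (S fun _ => c) =ᵐ[ν] fun _ => c := by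
  have h0 : ν (Φ ∅) = 0 := (h.null ∅ MeasurableSet.empty).1 (by simp)
  have h1 := h.ind Set.univ MeasurableSet.univ
  have h2 := h.compl ∅ MeasurableSet.empty
  have h3 := h.smul c (Set.univ.indicator fun _ => (1 : ℝ))
    (measurable_const.indicator MeasurableSet.univ)
  simp only [Set.indicator_univ, Set.compl_empty, mul_one] at h1 h2 h3
  have h4 : ∀ᵐ b ∂ν, b ∉ Φ ∅ := measure_eq_zero_iff_ae_notMem.1 h0
  filter_upwards [h1, h2.mem_iff, h3, h4] with b h1 h2 h3 h4
  rw [h3, h1, Set.indicator_of_mem (h2.2 h4)]; ring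

theorem off_pos (h : ShiftData μ ν Φ S) {f : A → ℝ} (hf : Measurable f) {s : Set A}
    (hs : MeasurableSet s) (h0 : ∀ a, 0 ≤ f a) (hz : ∀ a, a ∉ s → f a = 0) :
    ∀ᵐ b ∂ν, b ∉ Φ s → S f b = 0 := by
  have hm : Measurable (sᶜ.indicator fun _ => (1 : ℝ)) := measurable_const.indicator hs.compl
  obtain ⟨k, hk, hkS⟩ := h.surj (fun b => min (S f b) (S (sᶜ.indicator fun _ => (1 : ℝ)) b))
    ((h.meas _ hf).min (h.meas _ hm))
  have h1 := h.le_of hk hf (by filter_upwards [hkS] with b hb; rw [hb]; exact min_le_left _ _)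
  have h2 := h.le_of hk hm (by filter_upwards [hkS] with b hb; rw [hb]; exact min_le_right _ _)
  have h3 : ∀ᵐ a ∂μ, k a ≤ 0 := by
    filter_upwards [h1, h2] with a h1 h2
    by_cases ha : a ∈ s
    · simpa [ha] using h2
    · rw [hz a ha] at h1; exact h1
  have h4 := h.mono hk measurable_const h3
  filter_upwards [h4, h.const 0, hkS, h.ind _ hs.compl, (h.compl s hs).mem_iff,
    h.pos f hf (Filter.Eventually.of_forall h0)] with b h4 h5 h6 h7 h8 h9 hb
  rw [h5, h6, h7, Set.indicator_of_mem (h8.2 hb)] at h4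
  rcases min_le_iff.1 h4 with h | h <;> linarith

theorem off (h : ShiftData μ ν Φ S) {f : A → ℝ} (hf : Measurable f) {s : Set A}
    (hs : MeasurableSet s) (hz : ∀ a, a ∉ s → f a = 0) :
    ∀ᵐ b ∂ν, b ∉ Φ s → S f b = 0 := by
  have m1 : Measurable fun a => max (f a) 0 := hf.max measurable_const
  have m2 : Measurable fun a => max (-f a) 0 := hf.neg.max measurable_const
  have h1 := h.off_pos m1 hs (by simp) (by intro a ha; simp [hz a ha])
  have h2 := h.off_pos m2 hs (by simp) (by intro a ha; simp [hz a ha])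
  have h3 := h.sub m1 m2
  have e : (fun a => max (f a) 0 - max (-f a) 0) = f := by
    ext a
    rcases le_total (f a) 0 with h | h
    · rw [max_eq_right h, max_eq_left (by linarith)]; ring
    · rw [max_eq_left h, max_eq_right (by linarith)]; ring
  rw [e] at h3
  filter_upwards [h1, h2, h3] with b h1 h2 h3 hb
  rw [h3, h1 hb, h2 hb]; ring

theorem mulInd (h : ShiftData μ ν Φ S) {f : A → ℝ} (hf : Measurable f) {s : Set A}
    (hs : MeasurableSet s) :
    (S fun a => f a * s.indicator (fun _ => (1 : ℝ)) a) =ᵐ[ν]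
      fun b => S f b * (Φ s).indicator (fun _ => (1 : ℝ)) b := by
  have m1 : Measurable fun a => f a * s.indicator (fun _ => (1 : ℝ)) a :=
    hf.mul (measurable_const.indicator hs)
  have m2 : Measurable fun a => f a * sᶜ.indicator (fun _ => (1 : ℝ)) a :=
    hf.mul (measurable_const.indicator hs.compl)
  have h1 := h.off m1 hs (by intro a ha; simp [ha])
  have h2 := h.off m2 hs.compl (by intro a ha; simp at ha; simp [ha])
  have h3 := h.add _ _ m1 m2
  have e : (fun a => f a * s.indicator (fun _ => (1 : ℝ)) a +
      f a * sᶜ.indicator (fun _ => (1 : ℝ)) a) = f := by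
    ext a
    by_cases ha : a ∈ s <;> simp [ha]
  rw [e] at h3
  filter_upwards [h1, h2, h3, (h.compl s hs).mem_iff] with b h1 h2 h3 h4
  by_cases hb : b ∈ Φ s
  · have : b ∉ Φ sᶜ := fun h' => h4.1 h' hb
    rw [h3, h2 this]; simp [hb]
  · rw [h1 hb]; simp [hb]

/-- a.e. convergence is preserved by `S`. -/
theorem tendsto_zero (h : ShiftData μ ν Φ S) {e : ℕ → A → ℝ} (he : ∀ n, Measurable (e n))
    (h0 : ∀ n a, 0 ≤ e n a)
    (ht : ∀ᵐ a ∂μ, Filter.Tendsto (fun n => e n a) Filter.atTop (nhds 0)) :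
    ∀ᵐ b ∂ν, Filter.Tendsto (fun n => S (e n) b) Filter.atTop (nhds 0) := by
  set E : ℕ → A → ℝ := fun n a => ⨆ m, e (n + m) a with hE
  have hEm : ∀ n, Measurable (E n) := fun n => Measurable.iSup fun m => he _
  have hbdd : ∀ᵐ a ∂μ, ∀ n, BddAbove (Set.range fun m => e (n + m) a) := by
    filter_upwards [ht] with a ha n
    obtain ⟨C, hC⟩ := ha.bddAbove_range
    exact ⟨C, by rintro _ ⟨m, rfl⟩; exact hC ⟨n + m, rfl⟩⟩
  have hE0 : ∀ n a, 0 ≤ E n a := fun n a => Real.iSup_nonneg fun m => h0 _ _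
  have hle : ∀ n m, ∀ᵐ a ∂μ, e (n + m) a ≤ E n a := by
    intro n m
    filter_upwards [hbdd] with a ha
    exact le_ciSup (ha n) m
  have hSle : ∀ᵐ b ∂ν, ∀ n m, S (e (n + m)) b ≤ S (E n) b := by
    rw [ae_all_iff]; intro n; rw [ae_all_iff]; intro m
    exact h.mono (he _) (hEm _) (hle n m)
  have hSe0 : ∀ᵐ b ∂ν, ∀ n, 0 ≤ S (e n) b := by
    rw [ae_all_iff]; intro n
    exact h.pos _ (he _) (Filter.Eventually.of_forall (h0 n))
  have hSE0 : ∀ᵐ b ∂ν, ∀ n, 0 ≤ S (E n) b := by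
    rw [ae_all_iff]; intro n
    exact h.pos _ (hEm _) (Filter.Eventually.of_forall (hE0 n))
  obtain ⟨v, hv, hvS⟩ := h.surj (fun b => ⨅ n, S (E n) b)
    (Measurable.iInf fun n => h.meas _ (hEm n))
  have hvE : ∀ᵐ a ∂μ, ∀ n, v a ≤ E n a := by
    rw [ae_all_iff]; intro n
    apply h.le_of hv (hEm n)
    filter_upwards [hvS, hSE0] with b hb hb0
    rw [hb]
    exact ciInf_le ⟨0, by rintro _ ⟨m, rfl⟩; exact hb0 m⟩ n
  have hv0 : ∀ᵐ a ∂μ, v a ≤ 0 := by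
    filter_upwards [hvE, ht] with a ha hta
    refine le_of_forall_pos_le_add fun ε hε => ?_
    obtain ⟨n, hn⟩ := Filter.eventually_atTop.1 (hta.eventually (gt_mem_nhds hε))
    refine (ha n).trans ?_
    rw [zero_add]
    exact ciSup_le fun m => (hn (n + m) (by omega)).le
  have hW := h.mono hv measurable_const hv0
  filter_upwards [hW, h.const 0, hvS, hSle, hSe0, hSE0] with b h1 h2 h3 h4 h5 h6
  rw [h2, h3] at h1
  rw [Metric.tendsto_atTop]
  intro ε hε
  obtain ⟨n, hn⟩ := exists_lt_of_ciInf_lt (lt_of_le_of_lt h1 hε)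
  refine ⟨n, fun m hm => ?_⟩
  obtain ⟨k, rfl⟩ := Nat.exists_eq_add_of_le hm
  rw [Real.dist_eq, sub_zero, abs_of_nonneg (h5 _)]
  exact (h4 n k).trans_lt hn

theorem tendsto (h : ShiftData μ ν Φ S) {f : A → ℝ} (hf : Measurable f)
    {g : ℕ → A → ℝ} (hg : ∀ n, Measurable (g n))
    (ht : ∀ᵐ a ∂μ, Filter.Tendsto (fun n => |f a - g n a|) Filter.atTop (nhds 0)) :
    ∀ᵐ b ∂ν, Filter.Tendsto (fun n => S (g n) b) Filter.atTop (nhds (S f b)) := by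
  have hm : ∀ n, Measurable fun a => |f a - g n a| := fun n => (hf.sub (hg n)).abs
  have h1 := h.tendsto_zero hm (fun n a => abs_nonneg _) ht
  have h2 : ∀ᵐ b ∂ν, ∀ n, |S (g n) b - S f b| ≤ S (fun a => |f a - g n a|) b := by
    rw [ae_all_iff]; intro n
    filter_upwards [h.sub hf (hg n), h.sub (hg n) hf,
      h.mono (hf.sub (hg n)) (hm n) (Filter.Eventually.of_forall fun a => le_abs_self _),
      h.mono ((hg n).sub hf) (hm n) (Filter.Eventually.of_forall fun a => by
        have := neg_le_abs (f a - g n a)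
        simp only [Pi.sub_apply]; linarith)] with b h1 h2 h3 h4
    have h3' : S (fun a => f a - g n a) b ≤ _ := h3
    have h4' : S (fun a => g n a - f a) b ≤ _ := h4
    rw [h1] at h3'
    rw [h2] at h4'
    exact abs_le.2 ⟨by linarith, by linarith⟩
  filter_upwards [h1, h2] with b h1 h2
  rw [tendsto_iff_dist_tendsto_zero]
  exact squeeze_zero (fun _ => dist_nonneg) h2 h1

end ShiftData

theorem ae_eq_of_null_iff {X : Type*} [MeasurableSpace X] {μ lam : Measure X}
    (h : ∀ s : Set X, μ s = 0 ↔ lam s = 0) : ae lam = ae μ := by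
  ext s
  rw [mem_ae_iff, mem_ae_iff, h]

theorem phi_bound (x : ℝ) : 0 ≤ |x| / (1 + |x|) ∧ |x| / (1 + |x|) < 1 := by
  have := abs_nonneg x
  constructor
  · positivity
  · rw [div_lt_one (by linarith)]; linarith

theorem phi_meas {X : Type*} [MeasurableSpace X] {f g : X → ℝ} (hf : Measurable f)
    (hg : Measurable g) : Measurable fun x => |f x - g x| / (1 + |f x - g x|) :=
  (hf.sub hg).abs.div (measurable_const.add (hf.sub hg).abs)

theorem phi_int {X : Type*} [MeasurableSpace X] (lam : Measure X) [IsFiniteMeasure lam]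
    {f g : X → ℝ} (hf : Measurable f) (hg : Measurable g) :
    Integrable (fun x => |f x - g x| / (1 + |f x - g x|)) lam := by
  refine Integrable.of_bound (phi_meas hf hg).aestronglyMeasurable 1
    (Filter.Eventually.of_forall fun x => ?_)
  rw [Real.norm_eq_abs, abs_of_nonneg (phi_bound _).1]
  exact (phi_bound _).2.le

theorem exists_subseq_of_rho {X : Type*} [MeasurableSpace X] (lam : Measure X)
    [IsFiniteMeasure lam] {f : X → ℝ} (hf : Measurable f) {g : ℕ → X → ℝ}
    (hg : ∀ n, Measurable (g n))
    (ht : Filter.Tendsto (fun n => rhoL0 lam f (g n)) Filter.atTop (nhds 0)) :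
    ∃ ns : ℕ → ℕ, StrictMono ns ∧
      ∀ᵐ x ∂lam, Filter.Tendsto (fun n => |f x - g (ns n) x|) Filter.atTop (nhds 0) := by
  have h1 : TendstoInMeasure lam (fun n x => |f x - g n x| / (1 + |f x - g n x|))
      Filter.atTop (fun _ => (0 : ℝ)) := by
    refine tendstoInMeasure_of_tendsto_eLpNorm (p := 1) one_ne_zero
      (fun n => (phi_meas hf (hg n)).aestronglyMeasurable) aestronglyMeasurable_const ?_
    have e : ∀ n, eLpNorm ((fun x => |f x - g n x| / (1 + |f x - g n x|)) - fun _ => (0 : ℝ)) 1 lam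
        = ENNReal.ofReal (rhoL0 lam f (g n)) := by
      intro n
      rw [eLpNorm_one_eq_lintegral_enorm, rhoL0,
        ofReal_integral_eq_lintegral_ofReal (phi_int lam hf (hg n))
          (Filter.Eventually.of_forall fun x => (phi_bound _).1)]
      refine lintegral_congr fun x => ?_
      simp only [Pi.sub_apply, sub_zero]
      rw [Real.enorm_eq_ofReal (phi_bound _).1]
    simp_rw [e]
    simpa using ENNReal.tendsto_ofReal ht
  obtain ⟨ns, hns, h2⟩ := h1.exists_seq_tendsto_ae
  refine ⟨ns, hns, ?_⟩
  filter_upwards [h2] with x hx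
  have h3 := hx.div (tendsto_const_nhds.sub hx : Filter.Tendsto (fun n => (1 : ℝ) - _) _ _)
    (by norm_num)
  simp only [sub_zero, div_one] at h3
  refine h3.congr fun n => ?_
  have := abs_nonneg (f x - g (ns n) x)
  simp only [Pi.div_apply]
  generalize |f x - g (ns n) x| = y at this
  have hy : 1 + y ≠ 0 := by positivity
  field_simp
  ring

theorem cont_of_rep {A B : Type*} [MeasurableSpace A] [MeasurableSpace B]
    {μ : Measure A} {ν : Measure B} {Φ : Set A → Set B} {S : (A → ℝ) → B → ℝ}
    (h : ShiftData μ ν Φ S)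
    (lamA : Measure A) [IsFiniteMeasure lamA] (lamB : Measure B) [IsFiniteMeasure lamB]
    (hA : ae lamA = ae μ) (hB : ae lamB = ae ν)
    (T : (A → ℝ) → B → ℝ)
    (hTmeas : ∀ f : A → ℝ, Measurable f → Measurable (T f))
    (N : B → ℝ → ℝ) (hc : ∀ᵐ b ∂ν, Continuous fun r => N b r)
    (hN : ∀ f : A → ℝ, Measurable f → T f =ᵐ[ν] fun b => N b (S f b))
    (f : A → ℝ) (hf : Measurable f) (ε : ℝ) (hε : 0 < ε) : ∃ δ : ℝ, 0 < δ ∧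
        ∀ g : A → ℝ, Measurable g → rhoL0 lamA f g < δ → rhoL0 lamB (T f) (T g) < ε := by
  by_contra hcon
  push Not at hcon
  choose g hg hg1 hg2 using fun n : ℕ => hcon (1 / ((n : ℝ) + 1)) (by positivity)
  have ht : Filter.Tendsto (fun n => rhoL0 lamA f (g n)) Filter.atTop (nhds 0) :=
    squeeze_zero (fun n => integral_nonneg fun x => (phi_bound _).1) (fun n => (hg1 n).le)
      tendsto_one_div_add_atTop_nhds_zero_nat
  obtain ⟨ns, -, hns⟩ := exists_subseq_of_rho lamA hf hg ht
  rw [hA] at hns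
  have hS := h.tendsto hf (fun n => hg (ns n)) hns
  have hT : ∀ᵐ b ∂ν, ∀ n, T (g (ns n)) b = N b (S (g (ns n)) b) := by
    rw [ae_all_iff]; exact fun n => hN _ (hg _)
  have hlim : Filter.Tendsto (fun n => rhoL0 lamB (T f) (T (g (ns n)))) Filter.atTop
      (nhds (∫ _, (0 : ℝ) ∂lamB)) := by
    refine tendsto_integral_of_dominated_convergence (fun _ => (1 : ℝ))
      (fun n => (phi_meas (hTmeas _ hf) (hTmeas _ (hg _))).aestronglyMeasurable)
      (integrable_const _) (fun n => Filter.Eventually.of_forall fun x => ?_) ?_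
    · rw [Real.norm_eq_abs, abs_of_nonneg (phi_bound _).1]
      exact (phi_bound _).2.le
    · rw [hB]
      filter_upwards [hS, hT, hc, hN f hf] with b h1 h2 h3 h4
      have h5 : Filter.Tendsto (fun n => T (g (ns n)) b) Filter.atTop (nhds (T f b)) := by
        simp_rw [h2]; rw [h4]
        exact (h3.tendsto _).comp h1
      have h6 : Filter.Tendsto (fun n => |T f b - T (g (ns n)) b|) Filter.atTop (nhds 0) := by
        have := (tendsto_const_nhds (x := T f b)).sub h5
        simpa using this.abs
      have h7 := h6.div (tendsto_const_nhds.add h6 : Filter.Tendsto (fun n => (1 : ℝ) + _) _ _)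
        (by norm_num)
      rw [add_zero, zero_div] at h7
      exact h7
  rw [integral_zero] at hlim
  exact absurd (ge_of_tendsto' hlim fun n => hg2 (ns n)) (not_le.2 hε)

/-- Measurable selection of a rational. -/
theorem exists_meas_rat {B : Type*} [MeasurableSpace B] (P : B → ℚ → Prop)
    (hP : ∀ b, ∃ q, P b q) (hm : ∀ q, MeasurableSet {b | P b q}) :
    ∃ s : B → ℚ, Measurable s ∧ ∀ b, P b (s b) := by
  classical
  obtain ⟨e, he⟩ := exists_surjective_nat ℚ
  have hP' : ∀ b, ∃ n : ℕ, P b (e n) := fun b => by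
    obtain ⟨q, hq⟩ := hP b
    obtain ⟨n, rfl⟩ := he q
    exact ⟨n, hq⟩
  exact ⟨fun b => e (Nat.find (hP' b)),
    (measurable_from_nat (f := e)).comp
      (measurable_find hP' fun k => hm _), fun b => Nat.find_spec (hP' b)⟩

section Rep

variable {A B : Type*} [MeasurableSpace A] [MeasurableSpace B]
    {μ : Measure A} {ν : Measure B} {Φ : Set A → Set B} {S : (A → ℝ) → B → ℝ}

theorem T_local (h : ShiftData μ ν Φ S) {T : (A → ℝ) → B → ℝ}
    (hTae : ∀ f g : A → ℝ, Measurable f → Measurable g → f =ᵐ[μ] g → T f =ᵐ[ν] T g)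
    (hat : ∀ f : A → ℝ, Measurable f → ∀ s : Set A, MeasurableSet s →
        (T fun a => f a * s.indicator (fun _ => (1 : ℝ)) a) =ᵐ[ν]
          fun b => T f b * (Φ s).indicator (fun _ => (1 : ℝ)) b)
    {f g : A → ℝ} (hf : Measurable f) (hg : Measurable g) {D : Set B} (hD : MeasurableSet D)
    (hfg : ∀ᵐ b ∂ν, b ∈ D → S f b = S g b) : ∀ᵐ b ∂ν, b ∈ D → T f b = T g b := by
  obtain ⟨s, hs, hsD⟩ := h.surjΦ D hD
  have mi : Measurable (s.indicator fun _ => (1 : ℝ)) := measurable_const.indicator hs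
  have h1 := h.inj _ _ (hf.mul mi) (hg.mul mi) (by
    filter_upwards [h.mulInd hf hs, h.mulInd hg hs, hsD.mem_iff, hfg] with b h1 h2 h3 h4
    refine h1.trans (Eq.trans ?_ h2.symm)
    by_cases hb : b ∈ Φ s
    · rw [h4 (h3.1 hb)]
    · simp [hb])
  have h2 := hTae _ _ (hf.mul mi) (hg.mul mi) h1
  filter_upwards [h2, hat f hf s hs, hat g hg s hs, hsD.mem_iff] with b h2 h3 h4 h5 hb
  have h6 := (h3.symm.trans h2).trans h4
  simpa [h5.2 hb] using h6

theorem T_rat (h : ShiftData μ ν Φ S) {T : (A → ℝ) → B → ℝ}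
    (hTae : ∀ f g : A → ℝ, Measurable f → Measurable g → f =ᵐ[μ] g → T f =ᵐ[ν] T g)
    (hat : ∀ f : A → ℝ, Measurable f → ∀ s : Set A, MeasurableSet s →
        (T fun a => f a * s.indicator (fun _ => (1 : ℝ)) a) =ᵐ[ν]
          fun b => T f b * (Φ s).indicator (fun _ => (1 : ℝ)) b)
    {f : A → ℝ} (hf : Measurable f) {q : B → ℚ} (hq : Measurable q)
    (hfq : ∀ᵐ b ∂ν, S f b = q b) : ∀ᵐ b ∂ν, T f b = T (fun _ => (q b : ℝ)) b := by
  have : ∀ᵐ b ∂ν, ∀ r : ℚ, b ∈ q ⁻¹' {r} → T f b = T (fun _ => (r : ℝ)) b := by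
    rw [ae_all_iff]; intro r
    apply T_local h hTae hat hf measurable_const (hq (measurableSet_singleton r))
    filter_upwards [hfq, h.const r] with b h1 h2 hb
    rw [h1, h2, show q b = r from hb]
  filter_upwards [this] with b hb
  exact hb (q b) rfl

theorem key_bad (h : ShiftData μ ν Φ S)
    (lamA : Measure A) [IsFiniteMeasure lamA] (lamB : Measure B) [IsFiniteMeasure lamB]
    (hA : ae lamA = ae μ) (hB : ae lamB = ae ν)
    {T : (A → ℝ) → B → ℝ}
    (hTmeas : ∀ f : A → ℝ, Measurable f → Measurable (T f))
    (hTae : ∀ f g : A → ℝ, Measurable f → Measurable g → f =ᵐ[μ] g → T f =ᵐ[ν] T g)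
    (hcont : ∀ f : A → ℝ, Measurable f → ∀ ε : ℝ, 0 < ε → ∃ δ : ℝ, 0 < δ ∧
        ∀ g : A → ℝ, Measurable g → rhoL0 lamA f g < δ → rhoL0 lamB (T f) (T g) < ε)
    (hat : ∀ f : A → ℝ, Measurable f → ∀ s : Set A, MeasurableSet s →
        (T fun a => f a * s.indicator (fun _ => (1 : ℝ)) a) =ᵐ[ν]
          fun b => T f b * (Φ s).indicator (fun _ => (1 : ℝ)) b)
    {f : A → ℝ} (hf : Measurable f) {ε : ℝ} (hε : 0 < ε) :
    ∀ᵐ b ∂ν, ∃ k : ℕ, ∀ q : ℚ, |(q : ℝ) - S f b| < 1 / ((k : ℝ) + 1) →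
      |T (fun _ => (q : ℝ)) b - T f b| < ε := by
  set Bad : Set B := {b | ∀ k : ℕ, ∃ q : ℚ, |(q : ℝ) - S f b| < 1 / ((k : ℝ) + 1) ∧
      ε ≤ |T (fun _ => (q : ℝ)) b - T f b|} with hBad
  have m1 : ∀ (k : ℕ) (q : ℚ), MeasurableSet {b | |(q : ℝ) - S f b| < 1 / ((k : ℝ) + 1)} :=
    fun k q => measurableSet_lt (measurable_const.sub (h.meas f hf)).abs measurable_const
  have m2 : ∀ q : ℚ, MeasurableSet {b | ε ≤ |T (fun _ => (q : ℝ)) b - T f b|} :=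
    fun q => measurableSet_le measurable_const
      ((hTmeas _ measurable_const).sub (hTmeas f hf)).abs
  have hBm : MeasurableSet Bad := by
    rw [hBad]
    simp only [Set.ofPred_forall, Set.ofPred_exists]
    exact MeasurableSet.iInter fun k => MeasurableSet.iUnion fun q => (m1 k q).inter (m2 q)
  suffices hnull : lamB Bad = 0 by
    have h1 : ∀ᵐ b ∂lamB, b ∉ Bad := measure_eq_zero_iff_ae_notMem.1 hnull
    rw [hB] at h1
    filter_upwards [h1] with b hb
    simp only [hBad, Set.mem_ofPred_eq] at hb
    push Not at hb
    exact hb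
  by_contra hne
  have hpos : 0 < lamB.real Bad := ENNReal.toReal_pos hne (measure_ne_top _ _)
  set c : ℝ := ε / (1 + ε) with hc
  have hc0 : 0 < c := by positivity
  obtain ⟨δ, hδ, hδ2⟩ := hcont f hf (c * lamB.real Bad) (by positivity)
  obtain ⟨k, hk⟩ : ∃ k : ℕ, lamA.real Set.univ * (1 / ((k : ℝ) + 1)) < δ := by
    have := tendsto_one_div_add_atTop_nhds_zero_nat (𝕜 := ℝ)
    have h2 := this.const_mul (lamA.real Set.univ)
    rw [mul_zero] at h2
    exact (h2.eventually (gt_mem_nhds hδ)).exists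
  obtain ⟨q, hq, hq2⟩ := exists_meas_rat
    (fun b q => |(q : ℝ) - S f b| < 1 / ((k : ℝ) + 1) ∧
      (b ∈ Bad → ε ≤ |T (fun _ => (q : ℝ)) b - T f b|))
    (fun b => by
      by_cases hb : b ∈ Bad
      · obtain ⟨q, h1, h2⟩ := hb k
        exact ⟨q, h1, fun _ => h2⟩
      · obtain ⟨q, h1, h2⟩ := exists_rat_btwn
          (show S f b < S f b + 1 / ((k : ℝ) + 1) by
            have : (0 : ℝ) < 1 / ((k : ℝ) + 1) := by positivity
            linarith)
        exact ⟨q, by rw [abs_lt]; constructor <;> linarith, fun h => absurd h hb⟩)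
    (fun q => (m1 k q).inter (hBm.imp (m2 q)))
  obtain ⟨g, hg, hgS⟩ := h.surj (fun b => (q b : ℝ))
    ((measurable_from_top (f := fun q : ℚ => (q : ℝ))).comp hq)
  have hTg := T_rat h hTae hat hg hq hgS
  have hclose : ∀ᵐ a ∂μ, |f a - g a| ≤ 1 / ((k : ℝ) + 1) := by
    have h1 := h.le_of (hf.sub hg) (measurable_const (a := 1 / ((k : ℝ) + 1))) (by
      filter_upwards [h.sub hf hg, h.const (1 / ((k : ℝ) + 1)), hgS] with b h1 h2 h3
      rw [h2]
      refine le_trans (le_of_eq h1) ?_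
      rw [h3]
      have := abs_lt.1 (hq2 b).1
      linarith [this.1])
    have h2 := h.le_of (hg.sub hf) (measurable_const (a := 1 / ((k : ℝ) + 1))) (by
      filter_upwards [h.sub hg hf, h.const (1 / ((k : ℝ) + 1)), hgS] with b h1 h2 h3
      rw [h2]
      refine le_trans (le_of_eq h1) ?_
      rw [h3]
      exact (abs_lt.1 (hq2 b).1).2.le)
    filter_upwards [h1, h2] with a h1 h2
    simp only [Pi.sub_apply] at h1 h2
    exact abs_le.2 ⟨by linarith, h1⟩
  have hr1 : rhoL0 lamA f g < δ := by
    refine lt_of_le_of_lt ?_ hk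
    have : ∫ _, (1 / ((k : ℝ) + 1)) ∂lamA = lamA.real Set.univ * (1 / ((k : ℝ) + 1)) := by
      rw [integral_const, smul_eq_mul]
    rw [← this]
    refine integral_mono_ae (phi_int lamA hf hg) (integrable_const _) ?_
    rw [Filter.EventuallyLE, hA]
    filter_upwards [hclose] with a ha
    refine le_trans (div_le_self (abs_nonneg _) ?_) ha
    linarith [abs_nonneg (f a - g a)]
  have hr2 := hδ2 g hg hr1
  have hr3 : c * lamB.real Bad ≤ rhoL0 lamB (T f) (T g) := by
    have e : ∫ b, Bad.indicator (fun _ => c) b ∂lamB = c * lamB.real Bad := by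
      rw [integral_indicator_const _ hBm, smul_eq_mul, mul_comm]
    rw [← e]
    refine integral_mono_ae ((integrable_const _).indicator hBm)
      (phi_int lamB (hTmeas f hf) (hTmeas g hg)) ?_
    rw [Filter.EventuallyLE, hB]
    filter_upwards [hTg] with b hb
    by_cases hbB : b ∈ Bad
    · rw [Set.indicator_of_mem hbB]
      have h1 := (hq2 b).2 hbB
      rw [← hb, abs_sub_comm] at h1
      rw [hc, div_le_div_iff₀ (by positivity) (by positivity)]
      nlinarith
    · rw [Set.indicator_of_notMem hbB]
      exact (phi_bound _).1
  linarith

end Rep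

theorem bad_null {B : Type*} [MeasurableSpace B] {ν : Measure B} (N0 : B → ℚ → ℝ)
    (hm : ∀ q, Measurable fun b => N0 b q)
    (hkey : ∀ u : B → ℝ, Measurable u → ∃ v : B → ℝ, ∀ ε : ℝ, 0 < ε → ∀ᵐ b ∂ν, ∃ k : ℕ,
      ∀ q : ℚ, |(q : ℝ) - u b| < 1 / ((k : ℝ) + 1) → |N0 b q - v b| < ε)
    (Bad : Set B) (M : ℕ) (η : ℝ) (hη : 0 < η)
    (hBad : Bad = {b | ∀ n : ℕ, ∃ p q : ℚ, |(p : ℝ)| ≤ M ∧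
      |(p : ℝ) - q| < 1 / ((n : ℝ) + 1) ∧ η ≤ |N0 b p - N0 b q|}) :
    MeasurableSet Bad ∧ ∀ᵐ b ∂ν, b ∉ Bad := by
  have m2 : ∀ p q : ℚ, MeasurableSet {b | η ≤ |N0 b p - N0 b q|} :=
    fun p q => measurableSet_le measurable_const ((hm p).sub (hm q)).abs
  have m3 : ∀ (n : ℕ) (p q : ℚ), MeasurableSet {b | |(p : ℝ)| ≤ M ∧
      |(p : ℝ) - q| < 1 / ((n : ℝ) + 1) ∧ η ≤ |N0 b p - N0 b q|} := fun n p q =>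
    (MeasurableSet.const _).inter ((MeasurableSet.const _).inter (m2 p q))
  have hBm : MeasurableSet Bad := by
    rw [hBad]
    simp only [Set.ofPred_forall, Set.ofPred_exists]
    exact MeasurableSet.iInter fun n => MeasurableSet.iUnion fun p =>
      MeasurableSet.iUnion fun q => m3 n p q
  refine ⟨hBm, ?_⟩
  have hsel : ∀ n : ℕ, ∃ s : B → ℚ, Measurable s ∧ ∀ b, |(s b : ℝ)| ≤ M ∧ (b ∈ Bad →
      ∃ q : ℚ, |(s b : ℝ) - q| < 1 / ((n : ℝ) + 1) ∧ η ≤ |N0 b (s b) - N0 b q|) := by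
    intro n
    refine exists_meas_rat (fun b p => |(p : ℝ)| ≤ M ∧ (b ∈ Bad →
      ∃ q : ℚ, |(p : ℝ) - q| < 1 / ((n : ℝ) + 1) ∧ η ≤ |N0 b p - N0 b q|)) ?_ ?_
    · intro b
      by_cases hb : b ∈ Bad
      · have hb' := hb
        rw [hBad] at hb'
        obtain ⟨p, q, h1, h2, h3⟩ := hb' n
        exact ⟨p, h1, fun _ => ⟨q, h2, h3⟩⟩
      · exact ⟨0, by simp, fun h => absurd h hb⟩
    · intro p
      refine (MeasurableSet.const _).inter (hBm.imp ?_)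
      simp only [Set.ofPred_exists]
      exact MeasurableSet.iUnion fun q => (MeasurableSet.const _).inter (m2 p q)
  choose s hs hs1 hs2 using hsel
  set u : B → ℝ := fun b => Filter.limsup (fun n => (s n b : ℝ)) Filter.atTop with hu
  have hum : Measurable u := Measurable.limsup fun n =>
    (measurable_from_top (f := fun q : ℚ => (q : ℝ))).comp (hs n)
  obtain ⟨v, hv⟩ := hkey u hum
  filter_upwards [hv (η / 2) (by positivity)] with b ⟨k, hk⟩ hb
  have hd : (0 : ℝ) < 1 / ((k : ℝ) + 1) := by positivity
  have bd1 : Filter.IsBoundedUnder (· ≤ ·) Filter.atTop (fun n => (s n b : ℝ)) :=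
    Filter.isBoundedUnder_of ⟨M, fun n => (abs_le.1 (hs1 n b)).2⟩
  have bd2 : Filter.IsBoundedUnder (· ≥ ·) Filter.atTop (fun n => (s n b : ℝ)) :=
    Filter.isBoundedUnder_of ⟨-M, fun n => (abs_le.1 (hs1 n b)).1⟩
  have e1 : ∀ᶠ n in Filter.atTop, (s n b : ℝ) < u b + 1 / ((k : ℝ) + 1) / 2 :=
    Filter.eventually_lt_of_limsup_lt (by show u b < _; linarith) bd1
  have e2 : ∃ᶠ n in Filter.atTop, u b - 1 / ((k : ℝ) + 1) / 2 < (s n b : ℝ) :=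
    Filter.frequently_lt_of_lt_limsup bd2.isCoboundedUnder_le (by show _ < u b; linarith)
  have e3 : ∀ᶠ n : ℕ in Filter.atTop, 1 / ((n : ℝ) + 1) < 1 / ((k : ℝ) + 1) / 2 :=
    (tendsto_one_div_add_atTop_nhds_zero_nat (𝕜 := ℝ)).eventually (gt_mem_nhds (by positivity))
  obtain ⟨n, h2, h1, h3⟩ := (e2.and_eventually (e1.and e3)).exists
  obtain ⟨q, hq1, hq2⟩ := hs2 n b hb
  rw [abs_lt] at hq1
  have a1 := hk (s n b) (by rw [abs_lt]; constructor <;> linarith)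
  have a2 := hk q (by rw [abs_lt]; constructor <;> linarith [hq1.1, hq1.2])
  rw [abs_lt] at a1 a2
  have : |N0 b (s n b) - N0 b q| < η := by
    rw [abs_lt]; constructor <;> linarith [a1.1, a1.2, a2.1, a2.2]
  linarith

theorem car_ext {B : Type*} [MeasurableSpace B] {ν : Measure B} (N0 : B → ℚ → ℝ)
    (hm : ∀ q, Measurable fun b => N0 b q)
    (hkey : ∀ u : B → ℝ, Measurable u → ∃ v : B → ℝ, ∀ ε : ℝ, 0 < ε → ∀ᵐ b ∂ν, ∃ k : ℕ,
      ∀ q : ℚ, |(q : ℝ) - u b| < 1 / ((k : ℝ) + 1) → |N0 b q - v b| < ε) :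
    ∃ N : B → ℝ → ℝ, (∀ r, Measurable fun b => N b r) ∧ (∀ b, Continuous fun r => N b r) ∧
      ∀ᵐ b ∂ν, ∀ r : ℝ, Filter.Tendsto (N0 b)
        (Filter.comap ((↑) : ℚ → ℝ) (nhds r)) (nhds (N b r)) := by
  classical
  set Bad : ℕ → ℕ → Set B := fun m M => {b | ∀ n : ℕ, ∃ p q : ℚ, |(p : ℝ)| ≤ M ∧
      |(p : ℝ) - q| < 1 / ((n : ℝ) + 1) ∧ 1 / ((m : ℝ) + 1) ≤ |N0 b p - N0 b q|} with hBad
  have hbn := fun m M => bad_null N0 hm hkey (Bad m M) M (1 / ((m : ℝ) + 1)) (by positivity) rfl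
  set G : Set B := (⋃ m, ⋃ M, Bad m M)ᶜ with hG
  have hGm : MeasurableSet G :=
    (MeasurableSet.iUnion fun m => MeasurableSet.iUnion fun M => (hbn m M).1).compl
  have hGae : ∀ᵐ b ∂ν, b ∈ G := by
    have : ∀ᵐ b ∂ν, ∀ m M, b ∉ Bad m M := by
      rw [ae_all_iff]; intro m; rw [ae_all_iff]; intro M; exact (hbn m M).2
    filter_upwards [this] with b hb
    simpa [hG] using hb
  set N1 : B → ℚ → ℝ := fun b q => if b ∈ G then N0 b q else 0 with hN1
  have hN1m : ∀ q, Measurable fun b => N1 b q := fun q =>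
    Measurable.ite hGm (hm q) measurable_const
  have di : IsDenseInducing ((↑) : ℚ → ℝ) := Rat.isDenseEmbedding_coe_real.isDenseInducing
  have hlim : ∀ b r, ∃ c, Filter.Tendsto (N1 b) (Filter.comap ((↑) : ℚ → ℝ) (nhds r)) (nhds c) := by
    intro b r
    by_cases hb : b ∈ G
    · have hN : N1 b = N0 b := by ext q; simp [hN1, hb]
      rw [hN]
      haveI := di.comap_nhds_neBot r
      refine cauchy_map_iff_exists_tendsto.1 ?_
      rw [Metric.cauchy_iff]
      refine ⟨inferInstance, fun ε hε => ?_⟩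
      obtain ⟨m, hm'⟩ := exists_nat_one_div_lt hε
      obtain ⟨M, hM⟩ := exists_nat_ge (|r| + 1)
      have hb' : b ∉ Bad m M := by
        intro h'
        exact hb (Set.mem_iUnion.2 ⟨m, Set.mem_iUnion.2 ⟨M, h'⟩⟩)
      simp only [hBad, Set.mem_ofPred_eq] at hb'
      push Not at hb'
      obtain ⟨n, hn⟩ := hb'
      have hd : (0 : ℝ) < 1 / ((n : ℝ) + 1) := by positivity
      have hd1 : 1 / ((n : ℝ) + 1) ≤ 1 := by
        rw [div_le_one (by positivity)]
        have : (0 : ℝ) ≤ n := Nat.cast_nonneg n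
        linarith
      refine ⟨N0 b '' (((↑) : ℚ → ℝ) ⁻¹' Metric.ball r (1 / ((n : ℝ) + 1) / 2)),
        Filter.image_mem_map (Filter.preimage_mem_comap (Metric.ball_mem_nhds _ (by positivity))),
        ?_⟩
      rintro _ ⟨p, hp, rfl⟩ _ ⟨q, hq, rfl⟩
      simp only [Set.mem_preimage, Metric.mem_ball, Real.dist_eq] at hp hq
      rw [abs_lt] at hp hq
      rw [Real.dist_eq]
      refine lt_trans (hn p q ?_ ?_) hm'
      · refine le_trans ?_ hM
        have h1 := le_abs_self r
        have h2 := neg_le_abs r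
        rw [abs_le]; constructor <;> linarith [hp.1, hp.2]
      · rw [abs_lt]; constructor <;> linarith [hp.1, hp.2, hq.1, hq.2]
    · refine ⟨0, ?_⟩
      have hN : N1 b = fun _ => 0 := by ext q; simp [hN1, hb]
      rw [hN]
      exact tendsto_const_nhds
  have hext : ∀ b r, Filter.Tendsto (N1 b) (Filter.comap ((↑) : ℚ → ℝ) (nhds r))
      (nhds (di.extend (N1 b) r)) := by
    intro b r
    obtain ⟨c, hc⟩ := hlim b r
    rw [di.extend_eq_of_tendsto hc]
    exact hc
  refine ⟨fun b => di.extend (N1 b), fun r => ?_, fun b => di.continuous_extend (hlim b), ?_⟩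
  · have hx : ∃ x : ℕ → ℚ, Filter.Tendsto (fun n => (x n : ℝ)) Filter.atTop (nhds r) := by
      have : ∀ n : ℕ, ∃ q : ℚ, r < q ∧ (q : ℝ) < r + 1 / ((n : ℝ) + 1) := fun n =>
        exists_rat_btwn (by
          have : (0 : ℝ) < 1 / ((n : ℝ) + 1) := by positivity
          linarith)
      choose x h1 h2 using this
      refine ⟨x, tendsto_of_tendsto_of_tendsto_of_le_of_le tendsto_const_nhds ?_
        (fun n => (h1 n).le) (fun n => (h2 n).le)⟩
      simpa using (tendsto_one_div_add_atTop_nhds_zero_nat (𝕜 := ℝ)).const_add r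
    obtain ⟨x, hx⟩ := hx
    refine measurable_of_tendsto_metrizable (fun n => hN1m (x n)) ?_
    rw [tendsto_pi_nhds]
    intro b
    exact (hext b r).comp (Filter.tendsto_comap_iff.2 hx)
  · filter_upwards [hGae] with b hb r
    have hN : N1 b = N0 b := by ext q; simp [hN1, hb]
    have := hext b r
    rw [hN] at this
    simpa [hN] using this

theorem rep_of_cont {A B : Type*} [MeasurableSpace A] [MeasurableSpace B]
    {μ : Measure A} {ν : Measure B} {Φ : Set A → Set B} {S : (A → ℝ) → B → ℝ}
    (h : ShiftData μ ν Φ S)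
    (lamA : Measure A) [IsFiniteMeasure lamA] (lamB : Measure B) [IsFiniteMeasure lamB]
    (hA : ae lamA = ae μ) (hB : ae lamB = ae ν)
    {T : (A → ℝ) → B → ℝ}
    (hTmeas : ∀ f : A → ℝ, Measurable f → Measurable (T f))
    (hTae : ∀ f g : A → ℝ, Measurable f → Measurable g → f =ᵐ[μ] g → T f =ᵐ[ν] T g)
    (hT0 : ∀ᵐ b ∂ν, T (fun _ => 0) b = 0)
    (hcont : ∀ f : A → ℝ, Measurable f → ∀ ε : ℝ, 0 < ε → ∃ δ : ℝ, 0 < δ ∧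
        ∀ g : A → ℝ, Measurable g → rhoL0 lamA f g < δ → rhoL0 lamB (T f) (T g) < ε)
    (hat : ∀ f : A → ℝ, Measurable f → ∀ s : Set A, MeasurableSet s →
        (T fun a => f a * s.indicator (fun _ => (1 : ℝ)) a) =ᵐ[ν]
          fun b => T f b * (Φ s).indicator (fun _ => (1 : ℝ)) b) :
    ∃ N : B → ℝ → ℝ, (∀ᵐ b ∂ν, N b 0 = 0) ∧
        (∀ r : ℝ, Measurable fun b => N b r) ∧
        (∀ᵐ b ∂ν, Continuous fun r => N b r) ∧
        ∀ f : A → ℝ, Measurable f → T f =ᵐ[ν] fun b => N b (S f b) := by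
  have hkey : ∀ f : A → ℝ, Measurable f → ∀ ε : ℝ, 0 < ε → ∀ᵐ b ∂ν, ∃ k : ℕ, ∀ q : ℚ,
      |(q : ℝ) - S f b| < 1 / ((k : ℝ) + 1) → |T (fun _ => (q : ℝ)) b - T f b| < ε :=
    fun f hf ε hε => key_bad h lamA lamB hA hB hTmeas hTae hcont hat hf hε
  obtain ⟨N, hN1, hN2, hN3⟩ := car_ext (ν := ν) (fun b q => T (fun _ => (q : ℝ)) b)
    (fun q => hTmeas _ measurable_const) (by
      intro u hu
      obtain ⟨f, hf, hfu⟩ := h.surj u hu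
      refine ⟨T f, fun ε hε => ?_⟩
      filter_upwards [hkey f hf ε hε, hfu] with b h1 h2
      rw [← h2]; exact h1)
  have hrep : ∀ f : A → ℝ, Measurable f → T f =ᵐ[ν] fun b => N b (S f b) := by
    intro f hf
    have h1 : ∀ᵐ b ∂ν, ∀ m : ℕ, ∃ k : ℕ, ∀ q : ℚ, |(q : ℝ) - S f b| < 1 / ((k : ℝ) + 1) →
        |T (fun _ => (q : ℝ)) b - T f b| < 1 / ((m : ℝ) + 1) := by
      rw [ae_all_iff]; exact fun m => hkey f hf _ (by positivity)
    filter_upwards [h1, hN3] with b h1 h3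
    haveI := Rat.isDenseEmbedding_coe_real.isDenseInducing.comap_nhds_neBot (S f b)
    refine tendsto_nhds_unique ?_ (h3 (S f b))
    rw [Metric.tendsto_nhds]
    intro ε hε
    obtain ⟨m, hm⟩ := exists_nat_one_div_lt hε
    obtain ⟨k, hk⟩ := h1 m
    have hmem : ((↑) : ℚ → ℝ) ⁻¹' Metric.ball (S f b) (1 / ((k : ℝ) + 1)) ∈
        Filter.comap ((↑) : ℚ → ℝ) (nhds (S f b)) :=
      Filter.preimage_mem_comap (Metric.ball_mem_nhds _ (by positivity))
    filter_upwards [hmem] with q hq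
    exact (hk q hq).trans hm
  refine ⟨N, ?_, hN1, Filter.Eventually.of_forall hN2, hrep⟩
  filter_upwards [hT0, hrep _ measurable_const, h.const 0] with b h1 h2 h3
  rw [h3, h1] at h2
  exact h2.symm

/-- representation of continuous atomic operators between spaces of
measurable functions. Let `Φ` be a Boolean isomorphism of the measure algebras of two
σ-finite measure spaces, `S` the associated shift operator and `T` a regular orthogonally
additive operator. Then `T` is continuous (for the metrics of convergence in measure) and
atomic subordinate to `Φ` if and only if `T f = N(·, (S f)(·))` a.e. for some
`𝔎`-function `N`. -/
theorem atomic_operator_representation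
    {A B : Type*} [MeasurableSpace A] [MeasurableSpace B]
    (μ : Measure A) [SigmaFinite μ] (ν : Measure B) [SigmaFinite ν]
    -- equivalent finite measures defining the metrics
    (lamA : Measure A) [IsFiniteMeasure lamA] (lamB : Measure B) [IsFiniteMeasure lamB]
    (hlamA : ∀ s : Set A, μ s = 0 ↔ lamA s = 0)
    (hlamB : ∀ s : Set B, ν s = 0 ↔ lamB s = 0)
    -- Φ is a Boolean isomorphism of the measure algebras
    (Φ : Set A → Set B)
    (hΦmeas : ∀ s : Set A, MeasurableSet s → MeasurableSet (Φ s))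
    (hΦnull : ∀ s : Set A, MeasurableSet s → (μ s = 0 ↔ ν (Φ s) = 0))
    (hΦinter : ∀ s t : Set A, MeasurableSet s → MeasurableSet t →
      (Φ (s ∩ t) : Set B) =ᵐ[ν] (Φ s ∩ Φ t : Set B))
    (hΦunion : ∀ s t : Set A, MeasurableSet s → MeasurableSet t →
      (Φ (s ∪ t) : Set B) =ᵐ[ν] (Φ s ∪ Φ t : Set B))
    (hΦcompl : ∀ s : Set A, MeasurableSet s → (Φ sᶜ : Set B) =ᵐ[ν] ((Φ s)ᶜ : Set B))
    (hΦsurj : ∀ D : Set B, MeasurableSet D →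
      ∃ s : Set A, MeasurableSet s ∧ (Φ s : Set B) =ᵐ[ν] D)
    -- S is the associated shift operator: a positive linear bijection with positive
    -- inverse, mapping indicators to indicators along Φ, preserving countable suprema
    (S : (A → ℝ) → B → ℝ)
    (hSmeas : ∀ f : A → ℝ, Measurable f → Measurable (S f))
    (hSae : ∀ f g : A → ℝ, Measurable f → Measurable g → f =ᵐ[μ] g → S f =ᵐ[ν] S g)
    (hSadd : ∀ f g : A → ℝ, Measurable f → Measurable g →
      (S fun a => f a + g a) =ᵐ[ν] fun b => S f b + S g b)
    (hSsmul : ∀ (c : ℝ) (f : A → ℝ), Measurable f →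
      (S fun a => c * f a) =ᵐ[ν] fun b => c * S f b)
    (hSpos : ∀ f : A → ℝ, Measurable f → (∀ᵐ a ∂μ, 0 ≤ f a) → ∀ᵐ b ∂ν, 0 ≤ S f b)
    (hSinvpos : ∀ f : A → ℝ, Measurable f → (∀ᵐ b ∂ν, 0 ≤ S f b) → ∀ᵐ a ∂μ, 0 ≤ f a)
    (hSinj : ∀ f g : A → ℝ, Measurable f → Measurable g → S f =ᵐ[ν] S g → f =ᵐ[μ] g)
    (hSsurj : ∀ g : B → ℝ, Measurable g → ∃ f : A → ℝ, Measurable f ∧ S f =ᵐ[ν] g)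
    (hSind : ∀ s : Set A, MeasurableSet s →
      (S (s.indicator fun _ => (1 : ℝ))) =ᵐ[ν] (Φ s).indicator fun _ => (1 : ℝ))
    (hSsup : ∀ f : ℕ → A → ℝ, (∀ n, Measurable (f n)) →
      (∀ n, ∀ᵐ a ∂μ, 0 ≤ f n a) → (∀ᵐ a ∂μ, Monotone fun n => f n a) →
      (∃ h : A → ℝ, ∀ n, ∀ᵐ a ∂μ, f n a ≤ h a) →
      (S fun a => ⨆ n, f n a) =ᵐ[ν] fun b => ⨆ n, S (f n) b)
    -- T is a regular, orthogonally additive operator from L⁰(μ) to L⁰(ν)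
    (T : (A → ℝ) → B → ℝ)
    (hTmeas : ∀ f : A → ℝ, Measurable f → Measurable (T f))
    (hTae : ∀ f g : A → ℝ, Measurable f → Measurable g → f =ᵐ[μ] g → T f =ᵐ[ν] T g)
    (hToa : ∀ f g : A → ℝ, Measurable f → Measurable g →
      (∀ᵐ a ∂μ, min |f a| |g a| = 0) →
      (T fun a => f a + g a) =ᵐ[ν] fun b => T f b + T g b)
    (hTreg : ∃ T₁ T₂ : (A → ℝ) → B → ℝ,
      (∀ f : A → ℝ, Measurable f → ∀ᵐ b ∂ν, 0 ≤ T₁ f b) ∧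
      (∀ f g : A → ℝ, Measurable f → Measurable g → (∀ᵐ a ∂μ, min |f a| |g a| = 0) →
        (T₁ fun a => f a + g a) =ᵐ[ν] fun b => T₁ f b + T₁ g b) ∧
      (∀ f : A → ℝ, Measurable f → ∀ᵐ b ∂ν, 0 ≤ T₂ f b) ∧
      (∀ f g : A → ℝ, Measurable f → Measurable g → (∀ᵐ a ∂μ, min |f a| |g a| = 0) →
        (T₂ fun a => f a + g a) =ᵐ[ν] fun b => T₂ f b + T₂ g b) ∧
      (∀ f : A → ℝ, Measurable f → T f =ᵐ[ν] fun b => T₁ f b - T₂ f b)) :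
    -- the equivalence
    (((∀ f : A → ℝ, Measurable f → ∀ ε : ℝ, 0 < ε → ∃ δ : ℝ, 0 < δ ∧
        ∀ g : A → ℝ, Measurable g → rhoL0 lamA f g < δ → rhoL0 lamB (T f) (T g) < ε) ∧
      (∀ f : A → ℝ, Measurable f → ∀ s : Set A, MeasurableSet s →
        (T fun a => f a * s.indicator (fun _ => (1 : ℝ)) a) =ᵐ[ν]
          fun b => T f b * (Φ s).indicator (fun _ => (1 : ℝ)) b))
    ↔
      (∃ N : B → ℝ → ℝ, (∀ᵐ b ∂ν, N b 0 = 0) ∧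
        (∀ r : ℝ, Measurable fun b => N b r) ∧
        (∀ᵐ b ∂ν, Continuous fun r => N b r) ∧
        ∀ f : A → ℝ, Measurable f → T f =ᵐ[ν] fun b => N b (S f b))) := by
  have h : ShiftData μ ν Φ S := ⟨hΦnull, hΦcompl, hΦsurj, hSmeas, hSae, hSadd, hSsmul, hSpos,
    hSinvpos, hSinj, hSsurj, hSind⟩
  have hA := ae_eq_of_null_iff hlamA
  have hB := ae_eq_of_null_iff hlamB
  constructor
  · rintro ⟨hcont, hat⟩
    refine rep_of_cont h lamA lamB hA hB hTmeas hTae ?_ hcont hat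
    have h0 := hToa (fun _ => 0) (fun _ => 0) measurable_const measurable_const (by simp)
    simp only [add_zero] at h0
    filter_upwards [h0] with b hb
    linarith
  · rintro ⟨N, hN0, hNm, hNc, hN⟩
    refine ⟨cont_of_rep h lamA lamB hA hB T hTmeas N hNc hN, fun f hf s hs => ?_⟩
    filter_upwards [hN _ (hf.mul (measurable_const.indicator hs)), hN f hf, h.mulInd hf hs, hN0]
      with b h1 h2 h3 h4
    refine h1.trans ?_
    show N b (S (fun a => f a * s.indicator (fun _ => (1 : ℝ)) a) b) = _
    rw [h3, h2]
    by_cases hb : b ∈ Φ s <;> simp [hb, h4]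
end
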